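/- Let p ≥ 2 and let n be a Nevanlinna function satisfying condition (1_p) with coefficients s₀,…,s_{2p}, and assume D_p > 0 (hence D_k > 0 for all k ≤ p). Let ŝ₀,…,ŝ_{2p−2} be the coefficients in the expansion of the Schur transform n̂(z) = −s₀/n(z) − z + s₁/s₀ (which satisfies condition (1_{p−1})), and let D̂_k be their Hankel determinants. Then D̂_k > 0 for k = 0,…,p−1, and the orthonormal polynomials of the first kind ê_k associated with (ŝ_j) satisfy ê_k(z) = d_{k+1}(z)/√s₀ for k = 0,…,p−1, where d_{k+1} are the polynomials of the second kind associated with (s_j). -/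

import Mathlib

open Filter Complex Polynomial

noncomputable section

/-- A Nevanlinna function: analytic on `ℂ ∖ ℝ`, symmetric with respect to conjugation,
and with non-negative imaginary part in the upper half plane. -/
def IsNevanlinna (n : ℂ → ℂ) : Prop :=
  AnalyticOn ℂ n {z : ℂ | z.im ≠ 0} ∧
  (∀ z : ℂ, z.im ≠ 0 → n ((starRingEnd ℂ) z) = (starRingEnd ℂ) (n z)) ∧
  (∀ z : ℂ, 0 < z.im → 0 ≤ (n z).im)

/-- Condition `(1_q)` with coefficients `s 0, …, s (2q)`:
`n(iy) = -s₀/(iy) - s₁/(iy)² - ⋯ - s_{2q}/(iy)^{2q+1} + o(|y|^{-(2q+1)})` as `y → ±∞`. -/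
def Cond1 (n : ℂ → ℂ) (q : ℕ) (s : ℕ → ℝ) : Prop :=
  Tendsto
    (fun y : ℝ => (Complex.I * y) ^ (2 * q + 1) *
      (n (Complex.I * y) +
        ∑ j ∈ Finset.range (2 * q + 1), (s j : ℂ) / (Complex.I * y) ^ (j + 1)))
    (atTop ⊔ atBot) (nhds 0)

/-- The Hankel determinant `D_k = det (s_{i+j})_{i,j=0}^{k}`. -/
def hankelDet (s : ℕ → ℝ) (k : ℕ) : ℝ :=
  (Matrix.of fun i j : Fin (k + 1) => s ((i : ℕ) + (j : ℕ))).det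

/-- The orthonormal polynomials of the first kind: `e₀(z) = 1/√s₀`, and for `k ≥ 1`,
`e_k(z) = (D_{k-1}D_k)^{-1/2}` times the determinant of the `(k+1)×(k+1)` matrix whose
`i`-th row (`i = 0,…,k-1`) is `(s_i, …, s_{i+k})` and whose last row is `(1, z, …, z^k)`. -/
def ePoly (s : ℕ → ℝ) : ℕ → Polynomial ℝ
  | 0 => Polynomial.C (1 / Real.sqrt (s 0))
  | (k + 1) =>
      Polynomial.C (1 / Real.sqrt (hankelDet s k * hankelDet s (k + 1))) *
        (Matrix.of fun i j : Fin (k + 2) =>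
          if (i : ℕ) < k + 1 then Polynomial.C (s ((i : ℕ) + (j : ℕ)))
          else Polynomial.X ^ (j : ℕ)).det

/-- The polynomials of the second kind: `d_k(z) = L_t((e_k(z) - e_k(t))/(z - t))`, where
`L` is the linear functional with `L(t^j) = s_j`; concretely, if `e_k = Σ_m a_m X^m`, then
`d_k = Σ_m a_m Σ_{r<m} s_r X^{m-1-r}`. -/
def dPoly (s : ℕ → ℝ) (k : ℕ) : Polynomial ℝ :=
  ∑ m ∈ Finset.range ((ePoly s k).natDegree + 1),
    Polynomial.C ((ePoly s k).coeff m) *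
      ∑ r ∈ Finset.range m, Polynomial.C (s r) * Polynomial.X ^ (m - 1 - r)


def shat (s : ℕ → ℝ) (j : ℕ) : ℝ :=
  -PowerSeries.coeff (j + 2) (PowerSeries.C (s 0) * (PowerSeries.mk s)⁻¹)

theorem tser_mul (s : ℕ → ℝ) (h0 : s 0 ≠ 0) :
    PowerSeries.mk s * (PowerSeries.C (s 0) * (PowerSeries.mk s)⁻¹) = PowerSeries.C (s 0) := by
  rw [mul_left_comm, PowerSeries.mul_inv_cancel, mul_one]
  simpa using h0

theorem tser_zero (s : ℕ → ℝ) (h0 : s 0 ≠ 0) :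
    PowerSeries.coeff 0 (PowerSeries.C (s 0) * (PowerSeries.mk s)⁻¹) = 1 := by
  have := congrArg (PowerSeries.coeff 0) (tser_mul s h0)
  rw [PowerSeries.coeff_mul] at this
  rw [Finset.Nat.sum_antidiagonal_eq_sum_range_succ_mk] at this
  simp only [Finset.sum_range_succ, Finset.sum_range_zero, PowerSeries.coeff_mk,
    PowerSeries.coeff_zero_C, zero_add, Nat.sub_zero] at this
  exact mul_left_cancel₀ h0 (by rw [this, mul_one])

theorem tser_one (s : ℕ → ℝ) (h0 : s 0 ≠ 0) :
    PowerSeries.coeff 1 (PowerSeries.C (s 0) * (PowerSeries.mk s)⁻¹) = -(s 1 / s 0) := by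
  have := congrArg (PowerSeries.coeff 1) (tser_mul s h0)
  rw [PowerSeries.coeff_mul, Finset.Nat.sum_antidiagonal_eq_sum_range_succ_mk] at this
  simp only [Finset.sum_range_succ, Finset.sum_range_zero, PowerSeries.coeff_mk,
    PowerSeries.coeff_C, Nat.sub_self, Nat.sub_zero, tser_zero s h0] at this
  norm_num at this
  field_simp
  simp at *
  linarith

/-- recursion -/
theorem shat_rec (s : ℕ → ℝ) (h0 : s 0 ≠ 0) (m : ℕ) :
    ∑ j ∈ Finset.range m, s (m - 1 - j) * shat s j = s (m + 1) - s 1 / s 0 * s m := by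
  have := congrArg (PowerSeries.coeff (m + 1)) (tser_mul s h0)
  rw [mul_comm, PowerSeries.coeff_mul, Finset.Nat.sum_antidiagonal_eq_sum_range_succ_mk,
    Finset.sum_range_succ', Finset.sum_range_succ'] at this
  have h1 := tser_one s h0
  have h2 := tser_zero s h0
  simp only [zero_add, PowerSeries.coeff_mk] at this
  rw [h1, h2, PowerSeries.coeff_C] at this
  simp only [Nat.add_eq_zero_iff, one_ne_zero, and_false, if_false] at this
  have e : ∑ j ∈ Finset.range m, s (m - 1 - j) * shat s j =
     -∑ k ∈ Finset.range m, (PowerSeries.coeff (k + 1 + 1))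
        (PowerSeries.C (s 0) * (PowerSeries.mk s)⁻¹) * s (m + 1 - (k + 1 + 1)) := by
    rw [← Finset.sum_neg_distrib]
    refine Finset.sum_congr rfl fun k hk => ?_
    have : m + 1 - (k + 1 + 1) = m - 1 - k := by omega
    rw [this, shat]; ring
  rw [e]
  simp only [Nat.add_sub_cancel, Nat.sub_zero] at this
  linarith

theorem hank_step (s : ℕ → ℝ) (h0 : s 0 ≠ 0) (i : ℕ) : ∀ j,
    s i * s j + ∑ a ∈ Finset.range i, ∑ b ∈ Finset.range j,
      s (i - 1 - a) * shat s (a + b) * s (j - 1 - b) = s 0 * s (i + j) := by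
  induction i with
  | zero => intro j; simp
  | succ i ih =>
    intro j
    have h := ih (j + 1)
    have e1 : ∑ a ∈ Finset.range (i+1), ∑ b ∈ Finset.range j,
        s (i + 1 - 1 - a) * shat s (a + b) * s (j - 1 - b) =
        ∑ a ∈ Finset.range i, ∑ b ∈ Finset.range j,
        s (i - 1 - a) * shat s (a + b + 1) * s (j - 1 - b) + s i * (s (j + 1) - s 1 / s 0 * s j) := by
      rw [Finset.sum_range_succ', ← shat_rec s h0 j, Finset.mul_sum]
      congr 1
      · refine Finset.sum_congr rfl fun a ha => Finset.sum_congr rfl fun b hb => ?_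
        rw [show i + 1 - 1 - (a + 1) = i - 1 - a by omega, show a + 1 + b = a + b + 1 by omega]
      · refine Finset.sum_congr rfl fun b hb => ?_
        simp; ring
    have e2 : ∑ a ∈ Finset.range i, ∑ b ∈ Finset.range (j+1),
        s (i - 1 - a) * shat s (a + b) * s (j + 1 - 1 - b) =
        ∑ a ∈ Finset.range i, ∑ b ∈ Finset.range j,
        s (i - 1 - a) * shat s (a + b + 1) * s (j - 1 - b) + s j * (s (i + 1) - s 1 / s 0 * s i) := by
      rw [← shat_rec s h0 i, Finset.mul_sum, ← Finset.sum_add_distrib]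
      refine Finset.sum_congr rfl fun a ha => ?_
      rw [Finset.sum_range_succ']
      congr 1
      · refine Finset.sum_congr rfl fun b hb => ?_
        rw [show j + 1 - 1 - (b + 1) = j - 1 - b by omega, ← add_assoc]
      · simp; ring
    rw [e2] at h
    rw [e1, show i + 1 + j = i + (j + 1) by omega, ← h]
    ring

/-- Toeplitz lower triangular matrix -/
def toep (R : Type*) [CommRing R] (s : ℕ → R) (m : ℕ) : Matrix (Fin m) (Fin m) R :=
  Matrix.of fun i j => if (j : ℕ) ≤ i then s (i - j) else 0

theorem det_toep {R : Type*} [CommRing R] (s : ℕ → R) (m : ℕ) :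
    (toep R s m).det = s 0 ^ m := by
  rw [Matrix.det_of_isLowerTriangular]
  · simp [toep]
  · intro i j hij
    simp only [toep, Matrix.of_apply]
    rw [if_neg]
    simpa using hij

/-- bordered matrix -/
def bord {R : Type*} [CommRing R] {m : ℕ} (M : Matrix (Fin m) (Fin m) R) :
    Matrix (Fin (m + 1)) (Fin (m + 1)) R :=
  Matrix.of (Fin.cons (Fin.cons 1 fun _ => 0) fun i => Fin.cons 0 (M i))

theorem det_bord {R : Type*} [CommRing R] {m : ℕ} (M : Matrix (Fin m) (Fin m) R) :
    (bord M).det = M.det := by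
  rw [Matrix.det_succ_row_zero, Fin.sum_univ_succ]
  have : (bord M).submatrix Fin.succ (Fin.succAbove 0) = M := by
    ext i j; simp [bord]
  rw [this]
  simp [bord]

theorem toep_apply_sum {R : Type*} [CommRing R] (s : ℕ → R) (m : ℕ) (i : Fin m) (f : Fin m → R) 
    (F : ℕ → R) (hF : ∀ a : Fin m, a ≤ i → f a = F a) :
    ∑ a, toep R s m i a * f a = ∑ a ∈ Finset.range (i + 1), s (i - a) * F a := by
  have : ∀ a : Fin m, toep R s m i a * f a =
      (fun a : ℕ => if a ≤ (i:ℕ) then s (i - a) * F a else 0) a := by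
    intro a
    simp only [toep, Matrix.of_apply]
    split_ifs with h
    · rw [hF a h]
    · simp
  rw [Finset.sum_congr rfl fun a _ => this a, Fin.sum_univ_eq_sum_range (fun a : ℕ => if a ≤ (i:ℕ) then s (i - a) * F a else 0), ← Finset.sum_filter]
  refine Finset.sum_congr ?_ fun _ _ => rfl
  ext a
  simp
  omega

theorem bord_mul_zero {R : Type*} [CommRing R] (s : ℕ → R) {m : ℕ} (M : Matrix (Fin m) (Fin m) R)
    (j : Fin (m + 1)) : (bord M * (toep R s (m + 1)).transpose) 0 j = s j := by
  simp [Matrix.mul_apply, Fin.sum_univ_succ, bord, toep]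

theorem bord_mul_succ {R : Type*} [CommRing R] (s : ℕ → R) {m : ℕ} (M : Matrix (Fin m) (Fin m) R)
    (i : Fin m) (j : Fin (m + 1)) (F : ℕ → R) (hF : ∀ b : Fin m, M i b = F b) :
    (bord M * (toep R s (m + 1)).transpose) i.succ j =
      ∑ b ∈ Finset.range j, s (j - 1 - b) * F b := by
  have := toep_apply_sum s (m + 1) j (bord M i.succ) (fun b => if b = 0 then 0 else F (b - 1)) (by
    intro a _
    refine Fin.cases ?_ (fun a => ?_) a
    · simp [bord]
    · simp [bord, hF])
  simp only [Matrix.mul_apply, Matrix.transpose_apply]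
  simp_rw [mul_comm (bord M i.succ _)]
  rw [this, Finset.sum_range_succ']
  simp
  refine Finset.sum_congr rfl fun b hb => ?_
  congr 2; omega

/-- scaled rows identity: row `i` of `A * (bord M * Aᵀ)` -/
theorem toep_bord_row {R : Type*} [CommRing R] [Algebra ℝ R] (s : ℕ → ℝ) (h0 : s 0 ≠ 0) {m : ℕ}
    (M : Matrix (Fin m) (Fin m) R) (i j : Fin (m + 1))
    (hM : ∀ a b : Fin m, (a : ℕ) < i → M a b = algebraMap ℝ R (shat s (a + b))) :
    ∑ a, toep R (fun r => algebraMap ℝ R (s r)) (m + 1) i a *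
      (bord M * (toep R (fun r => algebraMap ℝ R (s r)) (m + 1)).transpose) a j =
      algebraMap ℝ R (s 0 * s (i + j)) := by
  rw [toep_apply_sum _ _ _ _ (fun a => if a = 0 then algebraMap ℝ R (s j) else
    ∑ b ∈ Finset.range j, algebraMap ℝ R (s (j - 1 - b)) * algebraMap ℝ R (shat s (a - 1 + b)))]
  · rw [← hank_step s h0, Finset.sum_range_succ']
    simp only [Nat.add_eq_zero_iff, one_ne_zero, and_false, if_false, if_true, Nat.sub_zero,
      Nat.add_sub_cancel, map_add, map_mul, map_sum]
    rw [add_comm]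
    congr 1
    refine Finset.sum_congr rfl fun a ha => ?_
    rw [Finset.mul_sum]
    refine Finset.sum_congr rfl fun b hb => ?_
    rw [show (i:ℕ) - (a + 1) = i - 1 - a by omega]
    ring
  · intro a
    refine Fin.cases ?_ (fun a => ?_) a
    · intro _; rw [bord_mul_zero]; simp
    · intro ha
      rw [bord_mul_succ _ _ _ _ (fun b => algebraMap ℝ R (shat s (a + b)))]
      · simp
      · intro b; apply hM
        have : ((a.succ : Fin (m+1)) : ℕ) ≤ i := ha
        simp at this; omega

theorem hankel_shat (s : ℕ → ℝ) (h0 : s 0 ≠ 0) (k : ℕ) :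
    hankelDet s (k + 1) = s 0 ^ (k + 2) * hankelDet (shat s) k := by
  have e : (s 0) • (Matrix.of fun i j : Fin (k + 2) => s ((i : ℕ) + (j : ℕ))) =
      toep ℝ s (k + 2) * (bord (Matrix.of fun i j : Fin (k + 1) => shat s ((i : ℕ) + (j : ℕ))) *
        (toep ℝ s (k + 2)).transpose) := by
    ext i j
    rw [Matrix.mul_apply]
    exact (toep_bord_row (R := ℝ) s h0 (Matrix.of fun i j : Fin (k + 1) => shat s ((i : ℕ) + (j : ℕ)))
      i j (fun a b _ => rfl)).symm
  have := congrArg Matrix.det e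
  rw [Matrix.det_smul, Matrix.det_mul, Matrix.det_mul, Matrix.det_transpose, det_toep, det_bord]
    at this
  simp only [Fintype.card_fin] at this
  refine mul_left_cancel₀ (pow_ne_zero (k + 2) h0) ?_
  unfold hankelDet
  rw [this]; ring

/-- the E matrix with general last row -/
def eMat (s : ℕ → ℝ) (k : ℕ) (Q : ℕ → Polynomial ℝ) : Matrix (Fin (k + 1)) (Fin (k + 1)) (Polynomial ℝ) :=
  Matrix.of fun i j => if (i : ℕ) < k then Polynomial.C (s ((i : ℕ) + (j : ℕ))) else Q j

def QPoly (s : ℕ → ℝ) (m : ℕ) : Polynomial ℝ :=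
  ∑ r ∈ Finset.range m, Polynomial.C (s r) * Polynomial.X ^ (m - 1 - r)

def wCoef (s : ℕ → ℝ) (k : ℕ) (j : ℕ) : ℝ :=
  if h : j < k + 1 then (-1) ^ (k + j) *
    (Matrix.of fun a b : Fin k => s ((a : ℕ) + ((⟨j, h⟩ : Fin (k + 1)).succAbove b : ℕ))).det else 0

theorem det_eMat (s : ℕ → ℝ) (k : ℕ) (Q : ℕ → Polynomial ℝ) :
    (eMat s k Q).det = ∑ j ∈ Finset.range (k + 1), Polynomial.C (wCoef s k j) * Q j := by
  rw [Matrix.det_succ_row _ (Fin.last k), ← Fin.sum_univ_eq_sum_range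
    (fun j => Polynomial.C (wCoef s k j) * Q j)]
  refine Finset.sum_congr rfl fun j _ => ?_
  have : (eMat s k Q).submatrix (Fin.last k).succAbove j.succAbove =
      (Polynomial.C : ℝ →+* ℝ[X]).mapMatrix
        (Matrix.of fun a b : Fin k => s ((a : ℕ) + (j.succAbove b : ℕ))) := by
    ext1 a b
    simp [eMat]
  rw [this, ← RingHom.map_det]
  simp [wCoef, eMat, j.2]
  ring

theorem dPoly_eq (s : ℕ → ℝ) (k : ℕ) :
    dPoly s (k + 1) = Polynomial.C (1 / Real.sqrt (hankelDet s k * hankelDet s (k + 1))) *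
      (eMat s (k + 1) (QPoly s)).det := by
  set c := 1 / Real.sqrt (hankelDet s k * hankelDet s (k + 1)) with hc
  have he : ePoly s (k + 1) = Polynomial.C c * (eMat s (k + 1) (fun j => X ^ j)).det := rfl
  rw [det_eMat] at he ⊢
  have hco : ∀ m, (ePoly s (k+1)).coeff m = if m < k + 2 then c * wCoef s (k + 1) m else 0 := by
    intro m
    rw [he, Polynomial.coeff_C_mul, Polynomial.finsetSum_coeff]
    simp [Polynomial.coeff_X_pow]
    simp only [show m < k + 2 ↔ m ≤ k + 1 by omega]
  have h1 : dPoly s (k + 1) = (ePoly s (k + 1)).sum (fun m a => Polynomial.C a * QPoly s m) := by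
    rw [Polynomial.sum_over_range _ (by simp)]
    rfl
  have hd : (ePoly s (k + 1)).natDegree < k + 2 := by
    rw [Nat.lt_succ_iff, Polynomial.natDegree_le_iff_coeff_eq_zero]
    intro m hm
    rw [hco, if_neg (by omega)]
  rw [h1, Polynomial.sum_over_range' _ (by simp) (k + 2) hd, Finset.mul_sum]
  refine Finset.sum_congr rfl fun m hm => ?_
  rw [hco, if_pos (Finset.mem_range.1 hm), Polynomial.C_mul, mul_assoc]

theorem det_eMat_shat (s : ℕ → ℝ) (h0 : s 0 ≠ 0) (k : ℕ) :
    (eMat s (k + 1) (QPoly s)).det = Polynomial.C (s 0 ^ (k + 2)) *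
      (eMat (shat s) k (fun j => X ^ j)).det := by
  set A := toep ℝ[X] (fun r => algebraMap ℝ ℝ[X] (s r)) (k + 2) with hA
  set M := eMat (shat s) k (fun j => X ^ j) with hM
  set B : Matrix (Fin (k + 2)) (Fin (k + 2)) ℝ[X] :=
    Matrix.of fun i j => if (i : ℕ) < k + 1 then A i j else if i = j then 1 else 0 with hB
  set Δ : Matrix (Fin (k + 2)) (Fin (k + 2)) ℝ[X] :=
    Matrix.diagonal fun i => if (i : ℕ) < k + 1 then Polynomial.C (s 0) else 1 with hΔ
  have e : Δ * eMat s (k + 1) (QPoly s) = B * (bord M * A.transpose) := by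
    ext1 i j
    rw [hΔ, Matrix.diagonal_mul, Matrix.mul_apply]
    by_cases hi : (i : ℕ) < k + 1
    · have := toep_bord_row (R := ℝ[X]) s h0 M i j (by
        intro a b ha
        simp [hM, eMat]
        intro; omega)
      simp only [hB, Matrix.of_apply, hi, if_true]
      rw [hA, this]
      simp only [eMat, Matrix.of_apply, hi, if_true, map_mul]; rfl
    · simp only [hB, Matrix.of_apply, hi, if_false]
      have hl : i = (Fin.last k).succ := by ext; simp; omega
      simp only [ite_mul, one_mul, zero_mul, Finset.sum_ite_eq, Finset.mem_univ, if_true]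
      rw [hl, hA, bord_mul_succ _ _ _ _ (fun b => X ^ b)]
      · simp only [eMat, Matrix.of_apply, Fin.val_succ, Fin.val_last, lt_irrefl, if_false, QPoly]
        rw [← Finset.sum_range_reflect]
        refine Finset.sum_congr rfl fun b hb => ?_
        have := Finset.mem_range.1 hb
        rw [show (j:ℕ) - 1 - (j - 1 - b) = b by omega]
        rfl
      · intro b; simp [hM, eMat]
  have := congrArg Matrix.det e
  have hBdet : B.det = Polynomial.C (s 0) ^ (k + 1) := by
    rw [Matrix.det_of_isLowerTriangular, Fin.prod_univ_castSucc]
    · simp [hB, hA, toep, Nat.lt_succ_iff.1 (Fin.is_lt _)]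
    · intro i j hij
      have hij' : i < j := by simpa using hij
      simp only [hB, Matrix.of_apply, hA, toep]
      rw [if_neg (show ¬ (j : ℕ) ≤ i from not_le.2 hij'), if_neg hij'.ne]; simp
  have hΔdet : Δ.det = Polynomial.C (s 0) ^ (k + 1) := by
    rw [hΔ, Matrix.det_diagonal, Fin.prod_univ_castSucc]
    simp [Nat.lt_succ_iff.1 (Fin.is_lt _)]
  rw [Matrix.det_mul, Matrix.det_mul, Matrix.det_mul, Matrix.det_transpose, hBdet, hΔdet, hA,
    det_toep, det_bord] at this
  have h := mul_left_cancel₀ (pow_ne_zero _ (by simpa using h0)) this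
  rw [h, Polynomial.C_pow, mul_comm]; rfl

theorem ePoly_shat (s : ℕ → ℝ) (h0 : 0 < s 0) (k : ℕ) (hD : ∀ j ≤ k + 1, 0 < hankelDet s j) :
    ePoly (shat s) k = Polynomial.C (1 / Real.sqrt (s 0)) * dPoly s (k + 1) := by
  rw [dPoly_eq, det_eMat_shat s h0.ne']
  have h2 := hankel_shat s h0.ne'
  cases k with
  | zero =>
    have e1 : (eMat (shat s) 0 (fun j => X ^ j)).det = 1 := by simp [eMat]
    have e2 : hankelDet s 0 = s 0 := by simp [hankelDet]
    have e3 : hankelDet (shat s) 0 = shat s 0 := by simp [hankelDet]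
    rw [e1, mul_one, ePoly, ← Polynomial.C_mul, ← Polynomial.C_mul, h2 0, e2, e3]
    congr 1
    have : s 0 * (s 0 ^ (0 + 2) * shat s 0) = (s 0) ^ 2 * (s 0 * shat s 0) := by ring
    rw [this, Real.sqrt_mul (by positivity), Real.sqrt_mul h0.le, Real.sqrt_sq h0.le]
    have q : 0 < √(s 0) := Real.sqrt_pos.2 h0
    have := Real.sq_sqrt h0.le
    have hs : 0 < shat s 0 := by
      have := hD 1 le_rfl
      rw [h2 0, e3] at this
      exact pos_of_mul_pos_right this (by positivity)
    have q' : 0 < √(shat s 0) := Real.sqrt_pos.2 hs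
    field_simp
    simp [this]; ring
  | succ k =>
    have e1 : ePoly (shat s) (k + 1) = Polynomial.C (1 / Real.sqrt (hankelDet (shat s) k *
      hankelDet (shat s) (k + 1))) * (eMat (shat s) (k + 1) (fun j => X ^ j)).det := rfl
    rw [e1, ← mul_assoc, ← mul_assoc, ← Polynomial.C_mul, ← Polynomial.C_mul, h2 k, h2 (k + 1)]
    congr 2
    have p1 : 0 < hankelDet (shat s) k := by
      have := hD (k + 1) (by omega)
      rw [h2 k] at this
      exact pos_of_mul_pos_right this (by positivity)
    have p2 : 0 < hankelDet (shat s) (k + 1) := by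
      have := hD (k + 2) (by omega)
      rw [h2 (k + 1)] at this
      exact pos_of_mul_pos_right this (by positivity)
    have : s 0 ^ (k + 2) * hankelDet (shat s) k * (s 0 ^ (k + 1 + 2) * hankelDet (shat s) (k + 1)) =
      (s 0 ^ (k + 2)) ^ 2 * (s 0 * (hankelDet (shat s) k * hankelDet (shat s) (k + 1))) := by ring
    rw [this, Real.sqrt_mul (sq_nonneg (s 0 ^ (k + 2))), Real.sqrt_mul h0.le, Real.sqrt_sq (by positivity)]
    have q : 0 < √(s 0) := Real.sqrt_pos.2 h0
    have := Real.sq_sqrt h0.le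
    have q' : 0 < √(hankelDet (shat s) k * hankelDet (shat s) (k + 1)) :=
      Real.sqrt_pos.2 (mul_pos p1 p2)
    field_simp
    rw [this]; ring

theorem tendsto_inv_I : Tendsto (fun y : ℝ => (Complex.I * y)⁻¹) (atTop ⊔ atBot) (nhds 0) := by
  have h : Tendsto (fun y : ℝ => ((y⁻¹ : ℝ) : ℂ) * (Complex.I)⁻¹) (atTop ⊔ atBot) (nhds 0) := by
    have : Tendsto (fun y : ℝ => y⁻¹) (atTop ⊔ atBot) (nhds 0) :=
      tendsto_sup.2 ⟨tendsto_inv_atTop_zero, tendsto_inv_atBot_zero⟩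
    have := ((Complex.continuous_ofReal.tendsto 0).comp this).mul_const (Complex.I)⁻¹
    simpa using this
  refine h.congr fun y => ?_
  push_cast
  rw [mul_inv, mul_comm]

theorem ev_ne : ∀ᶠ y : ℝ in (atTop ⊔ atBot), (Complex.I * y) ≠ 0 := by
  have : ∀ᶠ y : ℝ in (atTop ⊔ atBot), y ≠ 0 :=
    eventually_sup.2 ⟨eventually_ne_atTop 0, eventually_ne_atBot 0⟩
  filter_upwards [this] with y hy
  simpa using hy

/-- truncated polynomial -/
def tp (t : ℕ → ℝ) (N : ℕ) : Polynomial ℂ :=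
  ∑ j ∈ Finset.range N, Polynomial.C (t j : ℂ) * X ^ j

theorem tp_tendsto (P : Polynomial ℂ) :
    Tendsto (fun y : ℝ => P.eval (Complex.I * y)⁻¹) (atTop ⊔ atBot) (nhds (P.eval 0)) :=
  (P.continuous.tendsto 0).comp tendsto_inv_I

theorem tp_coeff (t : ℕ → ℝ) (N m : ℕ) : (tp t N).coeff m = if m < N then (t m : ℂ) else 0 := by
  simp [tp, Polynomial.finsetSum_coeff, Polynomial.coeff_X_pow]

theorem tp_eval_zero (t : ℕ → ℝ) (N : ℕ) : (tp t (N + 1)).eval 0 = t 0 := by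
  rw [← Polynomial.coeff_zero_eq_eval_zero, tp_coeff]; simp

theorem cond_iff (n : ℂ → ℂ) (p : ℕ) (s : ℕ → ℝ) (h : Cond1 n p s) :
    Tendsto (fun y : ℝ => (Complex.I * y) ^ (2 * p) *
      ((Complex.I * y) * n (Complex.I * y) + (tp s (2 * p + 1)).eval (Complex.I * y)⁻¹))
      (atTop ⊔ atBot) (nhds 0) := by
  refine h.congr' ?_
  filter_upwards [ev_ne] with y hy
  generalize Complex.I * (y:ℂ) = z at *
  have : z * ∑ j ∈ Finset.range (2 * p + 1), (s j : ℂ) / z ^ (j + 1) =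
      (tp s (2 * p + 1)).eval z⁻¹ := by
    rw [tp, Polynomial.eval_finsetSum, Finset.mul_sum]
    refine Finset.sum_congr rfl fun j _ => ?_
    simp
    field_simp
    ring
  rw [← this]; ring

theorem cond_lim (n : ℂ → ℂ) (p : ℕ) (s : ℕ → ℝ) (h : Cond1 n p s) :
    Tendsto (fun y : ℝ => (Complex.I * y) * n (Complex.I * y)) (atTop ⊔ atBot) (nhds (-(s 0 : ℂ))) := by
  have h1 := ((cond_iff n p s h).mul (tendsto_inv_I.pow (2 * p))).sub (tp_tendsto (tp s (2 * p + 1)))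
  rw [tp_eval_zero, zero_mul, zero_sub] at h1
  refine h1.congr' ?_
  filter_upwards [ev_ne] with y hy
  rw [mul_right_comm, ← mul_pow, mul_inv_cancel₀ hy, one_pow]
  ring

theorem cond_exists (n : ℂ → ℂ) (p : ℕ) (s : ℕ → ℝ) (h0 : s 0 ≠ 0) (h : Cond1 n (p + 1) s) :
    Cond1 (fun z : ℂ => -(s 0 : ℂ) / n z - z + (s 1 : ℂ) / (s 0 : ℂ)) p (shat s) := by
  set τ : ℕ → ℝ := fun j => PowerSeries.coeff j (PowerSeries.C (s 0) * (PowerSeries.mk s)⁻¹) with hτ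
  set S := tp s (2 * (p + 1) + 1) with hS
  set T := tp τ (2 * (p + 1) + 1) with hT
  have hdvd : X ^ (2 * (p + 1) + 1) ∣ Polynomial.C (s 0 : ℂ) - S * T := by
    rw [Polynomial.X_pow_dvd_iff]
    intro d hd
    have := congrArg (PowerSeries.coeff d) (tser_mul s h0)
    rw [PowerSeries.coeff_mul] at this
    rw [Polynomial.coeff_sub, Polynomial.coeff_mul, Polynomial.coeff_C]
    have e : ∑ x ∈ Finset.HasAntidiagonal.antidiagonal d, S.coeff x.1 * T.coeff x.2 =
      ((∑ x ∈ Finset.HasAntidiagonal.antidiagonal d, s x.1 * τ x.2 : ℝ) : ℂ) := by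
      push_cast
      refine Finset.sum_congr rfl fun x hx => ?_
      have := Finset.HasAntidiagonal.mem_antidiagonal.1 hx
      rw [hS, hT, tp_coeff, tp_coeff, if_pos (by omega), if_pos (by omega)]
    simp only [PowerSeries.coeff_mk] at this
    rw [e, this, PowerSeries.coeff_C]
    split_ifs <;> simp
  obtain ⟨R, hR⟩ := hdvd
  have h1 := cond_iff n (p + 1) s h
  have hlim := cond_lim n (p + 1) s h
  have hT0 := tp_tendsto T
  have hR0 := tendsto_inv_I.mul (tp_tendsto R)
  have hfin := (hR0.add (h1.mul hT0)).div hlim.neg (by simpa using h0)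
  simp only [zero_mul, add_zero, zero_div] at hfin
  have hne : ∀ᶠ y : ℝ in (atTop ⊔ atBot), (Complex.I * y) * n (Complex.I * y) ≠ 0 :=
    hlim.eventually_ne (by simpa using h0)
  refine hfin.congr' ?_
  filter_upwards [ev_ne, hne] with y hy hn
  simp only [Pi.div_apply]
  have hRe := congrArg (Polynomial.eval (Complex.I * (y:ℂ))⁻¹) hR
  simp only [Polynomial.eval_sub, Polynomial.eval_mul, Polynomial.eval_C, Polynomial.eval_pow,
    Polynomial.eval_X] at hRe
  have hTe : T.eval (Complex.I * (y:ℂ))⁻¹ = 1 - (s 1 / s 0 : ℂ) * (Complex.I * (y:ℂ))⁻¹ -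
     (Complex.I * (y:ℂ))⁻¹ * ∑ j ∈ Finset.range (2 * p + 1), (shat s j : ℂ) / (Complex.I * y) ^ (j + 1) := by
    rw [hT, tp, show 2 * (p + 1) + 1 = 2 * p + 1 + 1 + 1 by ring, Finset.sum_range_succ',
      Finset.sum_range_succ', Polynomial.eval_add, Polynomial.eval_add, Polynomial.eval_finsetSum]
    have t0 : τ 0 = 1 := tser_zero s h0
    have t1 : τ (0 + 1) = -(s 1 / s 0) := tser_one s h0
    rw [t0, t1, Finset.mul_sum]
    have : ∀ j, τ (j + 1 + 1) = - shat s j := by intro j; simp [hτ, shat]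
    simp only [this]
    simp only [Polynomial.eval_mul, Polynomial.eval_C, Polynomial.eval_pow,
      Polynomial.eval_X]
    have e : ∀ j : ℕ, ((-shat s j : ℝ) : ℂ) * (Complex.I * (y:ℂ))⁻¹ ^ (j + 1 + 1) =
      - ((Complex.I * (y:ℂ))⁻¹ * ((shat s j : ℂ) / (Complex.I * y) ^ (j + 1))) := by
      intro j
      push_cast
      rw [pow_succ, div_eq_mul_inv, inv_pow]; ring
    simp only [e, Finset.sum_neg_distrib]
    push_cast
    ring
  generalize (∑ j ∈ Finset.range (2 * p + 1), (shat s j : ℂ) / (Complex.I * y) ^ (j + 1)) = G at *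
  have h0c : (s 0 : ℂ) ≠ 0 := by exact_mod_cast h0
  generalize Complex.I * (y:ℂ) = z at *
  have hS' : G = z - (s 1 / s 0 : ℂ) - z * T.eval z⁻¹ := by
    rw [hTe]; field_simp; ring
  rw [hS']
  have hz : n z ≠ 0 := right_ne_zero_of_mul hn
  have hRe' : z⁻¹ * R.eval z⁻¹ = z ^ (2 * (p + 1)) * (s 0 - S.eval z⁻¹ * T.eval z⁻¹) := by
    rw [hRe, ← mul_assoc]; congr 1
    rw [pow_succ (z⁻¹), ← mul_assoc, ← mul_pow, mul_inv_cancel₀ hy, one_pow, one_mul]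
  rw [hRe', ← hS]
  generalize T.eval z⁻¹ = t
  generalize S.eval z⁻¹ = σ
  rw [show 2 * (p + 1) = 2 * p + 1 + 1 by ring, pow_succ z (2 * p + 1)]
  field_simp
  ring

theorem cond_unique (n : ℂ → ℂ) (p : ℕ) (s s' : ℕ → ℝ) (n' : ℂ → ℂ)
    (hnn : ∀ y : ℝ, 0 < y → n (Complex.I * y) = n' (Complex.I * y)) (h : Cond1 n p s)
    (h' : Cond1 n' p s') : ∀ j ≤ 2 * p, s j = s' j := by
  set P : Polynomial ℂ := ∑ j ∈ Finset.range (2 * p + 1), Polynomial.C ((s j - s' j : ℝ) : ℂ) * X ^ (2 * p - j) with hP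
  have h1 : Tendsto (fun y : ℝ => P.eval (Complex.I * (y:ℂ))) atTop (nhds 0) := by
    have := ((cond_iff n p s h).mono_left le_sup_left).sub ((cond_iff n' p s' h').mono_left le_sup_left)
    rw [sub_zero] at this
    refine this.congr' ?_
    filter_upwards [ev_ne.filter_mono le_sup_left, eventually_gt_atTop 0] with y hy hy0
    rw [hnn y hy0]
    generalize Complex.I * (y:ℂ) = z at *
    rw [← mul_sub, add_sub_add_left_eq_sub, hP, tp, tp, Polynomial.eval_finsetSum,
      Polynomial.eval_finsetSum, Polynomial.eval_finsetSum, ← Finset.sum_sub_distrib, Finset.mul_sum]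
    refine Finset.sum_congr rfl fun j hj => ?_
    have : j ≤ 2 * p := by simpa [Nat.lt_succ_iff] using hj
    simp only [Polynomial.eval_mul, Polynomial.eval_C, Polynomial.eval_pow, Polynomial.eval_X]
    rw [pow_sub₀ _ hy this]
    push_cast
    rw [inv_pow]; ring
  have hdeg : ¬ 0 < P.degree := by
    intro hd
    have hz : Tendsto (fun y : ℝ => ‖Complex.I * (y:ℂ)‖) atTop atTop := by
      simpa using tendsto_abs_atTop_atTop
    have := P.tendsto_norm_atTop hd hz
    exact not_tendsto_nhds_of_tendsto_atTop this _ h1.norm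
  have hC := Polynomial.eq_C_of_degree_le_zero (not_lt.1 hdeg)
  have hP0 : P = 0 := by
    rw [hC] at h1 ⊢
    simp only [Polynomial.eval_C] at h1
    rw [tendsto_nhds_unique tendsto_const_nhds h1, map_zero]
  intro j hj
  have := congrArg (fun Q => Polynomial.coeff Q (2 * p - j)) hP0
  simp only [hP, Polynomial.finsetSum_coeff, Polynomial.coeff_C_mul, Polynomial.coeff_X_pow,
    Polynomial.coeff_zero] at this
  rw [Finset.sum_eq_single j] at this
  · simp at this
    exact sub_eq_zero.1 (by exact_mod_cast this)
  · intro b hb hbj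
    have : b ≤ 2 * p := by simpa [Nat.lt_succ_iff] using hb
    rw [if_neg (by omega), mul_zero]
  · intro hh; simp at hh; omega

theorem normSq_sub_conj (a b : ℂ) :
    Complex.normSq (a - (starRingEnd ℂ) b) = Complex.normSq (a - b) + 4 * a.im * b.im := by
  simp [Complex.normSq_apply]; ring

/-- strict version of Schwarz-Pick in the upper half plane -/
theorem pick_strict (f : ℂ → ℂ) (hd : DifferentiableOn ℂ f {z | 0 < z.im})
    (hf : ∀ z : ℂ, 0 < z.im → 0 < (f z).im) (z w : ℂ) (hz : 0 < z.im) (hw : 0 < w.im) :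
    z.im * w.im * Complex.normSq (f z - (starRingEnd ℂ) (f w)) ≤
      (f z).im * (f w).im * Complex.normSq (z - (starRingEnd ℂ) w) := by
  set φ : ℂ → ℂ := fun ζ => (w - (starRingEnd ℂ) w * ζ) / (1 - ζ) with hφ
  set h : ℂ → ℂ := fun ζ => (f (φ ζ) - f w) / (f (φ ζ) - (starRingEnd ℂ) (f w)) with hh
  have h1 : ∀ ζ ∈ Metric.ball (0:ℂ) 1, 1 - ζ ≠ 0 := by
    intro ζ hζ hc
    have : ζ = 1 := by linear_combination -hc
    simp [this] at hζ
  have hφim : ∀ ζ ∈ Metric.ball (0:ℂ) 1, 0 < (φ ζ).im := by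
    intro ζ hζ
    have hn : Complex.normSq ζ < 1 := by
      rw [Complex.normSq_eq_norm_sq]
      have : ‖ζ‖ < 1 := by simpa using hζ
      nlinarith [norm_nonneg ζ]
    have : (φ ζ).im = w.im * (1 - Complex.normSq ζ) / Complex.normSq (1 - ζ) := by
      simp only [hφ, Complex.div_im]
      have := Complex.normSq_pos.2 (h1 ζ hζ)
      field_simp
      simp [Complex.normSq_apply]; ring
    rw [this]
    exact div_pos (mul_pos hw (by linarith)) (Complex.normSq_pos.2 (h1 ζ hζ))
  have hden : ∀ u : ℂ, 0 < u.im → f u - (starRingEnd ℂ) (f w) ≠ 0 := by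
    intro u hu hc
    have := congrArg Complex.im hc
    simp at this
    linarith [hf u hu, hf w hw]
  have hφd : DifferentiableOn ℂ φ (Metric.ball 0 1) := by
    intro ζ hζ
    apply DifferentiableAt.differentiableWithinAt
    have := h1 ζ hζ
    simp only [hφ]
    fun_prop (disch := assumption)
  have hfd : DifferentiableOn ℂ (fun ζ => f (φ ζ)) (Metric.ball 0 1) :=
    hd.comp hφd (fun ζ hζ => hφim ζ hζ)
  have hhd : DifferentiableOn ℂ h (Metric.ball 0 1) :=
    (hfd.sub_const _).div (hfd.sub_const _) (fun ζ hζ => hden _ (hφim ζ hζ))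
  have hmaps : Set.MapsTo h (Metric.ball 0 1) (Metric.closedBall 0 1) := by
    intro ζ hζ
    have hp := Complex.normSq_pos.2 (hden _ (hφim ζ hζ))
    have : Complex.normSq (h ζ) ≤ 1 := by
      simp only [hh]
      rw [map_div₀, div_le_one hp, normSq_sub_conj]
      have := mul_pos (hf _ (hφim ζ hζ)) (hf w hw)
      linarith
    rw [Complex.normSq_eq_norm_sq] at this
    simp only [Metric.mem_closedBall, dist_zero_right]
    nlinarith [norm_nonneg (h ζ)]
  have hzw : z - (starRingEnd ℂ) w ≠ 0 := by
    intro hc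
    have := congrArg Complex.im hc
    simp at this
    linarith
  have hzwp := Complex.normSq_pos.2 hzw
  set ζ := (z - w) / (z - (starRingEnd ℂ) w) with hζ
  have hζ1 : ‖ζ‖ < 1 := by
    have : Complex.normSq ζ < 1 := by
      rw [hζ, map_div₀, div_lt_one hzwp, normSq_sub_conj]
      have := mul_pos hz hw
      linarith
    rw [Complex.normSq_eq_norm_sq] at this
    nlinarith [norm_nonneg ζ]
  have key := Complex.norm_le_norm_of_mapsTo_ball hhd hmaps (by simp [hh, hφ]) hζ1
  have hφζ : φ ζ = z := by
    have : 1 - ζ ≠ 0 := h1 ζ (by simpa using hζ1)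
    simp only [hφ]
    rw [div_eq_iff this, hζ]
    field_simp
    ring
  have key2 : Complex.normSq (h ζ) ≤ Complex.normSq ζ := by
    rw [Complex.normSq_eq_norm_sq, Complex.normSq_eq_norm_sq]
    gcongr
  have hp := Complex.normSq_pos.2 (hden z hz)
  simp only [hh] at key2
  rw [hφζ, map_div₀, hζ, map_div₀, div_le_div_iff₀ hp hzwp] at key2
  have e1 := normSq_sub_conj (f z) (f w)
  have e2 := normSq_sub_conj z w
  have e1' : Complex.normSq (f z - f w) = Complex.normSq (f z - (starRingEnd ℂ) (f w)) - 4 * (f z).im * (f w).im := by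
    linarith
  have e2' : Complex.normSq (z - w) = Complex.normSq (z - (starRingEnd ℂ) w) - 4 * z.im * w.im := by
    linarith
  rw [e1', e2'] at key2
  linarith

theorem pick (f : ℂ → ℂ) (hd : DifferentiableOn ℂ f {z | 0 < z.im})
    (hf : ∀ z : ℂ, 0 < z.im → 0 ≤ (f z).im) (z w : ℂ) (hz : 0 < z.im) (hw : 0 < w.im) :
    z.im * w.im * Complex.normSq (f z - (starRingEnd ℂ) (f w)) ≤
      (f z).im * (f w).im * Complex.normSq (z - (starRingEnd ℂ) w) := by
  have h : ∀ ε : ℝ, 0 < ε → z.im * w.im * Complex.normSq ((f z + ε * Complex.I) -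
      (starRingEnd ℂ) (f w + ε * Complex.I)) ≤
      ((f z).im + ε) * ((f w).im + ε) * Complex.normSq (z - (starRingEnd ℂ) w) := by
    intro ε hε
    have := pick_strict (fun z => f z + ε * Complex.I) (hd.add_const _)
      (fun z hz => by have := hf z hz; simp; linarith) z w hz hw
    simpa using this
  have hl : Tendsto (fun ε : ℝ => z.im * w.im * Complex.normSq ((f z + ε * Complex.I) -
      (starRingEnd ℂ) (f w + ε * Complex.I))) (nhdsWithin 0 (Set.Ioi 0))
      (nhds (z.im * w.im * Complex.normSq (f z - (starRingEnd ℂ) (f w)))) := by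
    have : Continuous (fun ε : ℝ => z.im * w.im * Complex.normSq ((f z + ε * Complex.I) -
      (starRingEnd ℂ) (f w + ε * Complex.I))) := by
      have := Complex.continuous_normSq
      have := Complex.continuous_conj
      fun_prop
    simpa using (this.tendsto 0).mono_left nhdsWithin_le_nhds
  have hr : Tendsto (fun ε : ℝ => ((f z).im + ε) * ((f w).im + ε) * Complex.normSq (z - (starRingEnd ℂ) w))
      (nhdsWithin 0 (Set.Ioi 0))
      (nhds ((f z).im * (f w).im * Complex.normSq (z - (starRingEnd ℂ) w))) := by
    have : Continuous (fun ε : ℝ => ((f z).im + ε) * ((f w).im + ε) * Complex.normSq (z - (starRingEnd ℂ) w)) := by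
      fun_prop
    simpa using (this.tendsto 0).mono_left nhdsWithin_le_nhds
  exact le_of_tendsto_of_tendsto hl hr (eventually_nhdsWithin_of_forall h)

theorem nev_diff (n : ℂ → ℂ) (hn : IsNevanlinna n) : DifferentiableOn ℂ n {z | 0 < z.im} :=
  hn.1.differentiableOn.mono (fun z (hz : 0 < z.im) => hz.ne')

/-- Julia type inequality -/
theorem julia (n : ℂ → ℂ) (hn : IsNevanlinna n) (p : ℕ) (s : ℕ → ℝ) (h : Cond1 n p s) :
    0 ≤ s 0 ∧ ∀ z : ℂ, 0 < z.im → z.im * Complex.normSq (n z) ≤ s 0 * (n z).im := by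
  have hl := (cond_lim n p s h).mono_left (le_sup_left : atTop ≤ atTop ⊔ atBot)
  have hu : Tendsto (fun y : ℝ => (Complex.I * y)⁻¹) atTop (nhds 0) := tendsto_inv_I.mono_left le_sup_left
  have him : Tendsto (fun y : ℝ => y * (n (Complex.I * y)).im) atTop (nhds (s 0)) := by
    have := ((Complex.continuous_re.tendsto _).comp hl).neg
    simpa [Function.comp_def] using this
  have hn0 : Tendsto (fun y : ℝ => n (Complex.I * y)) atTop (nhds 0) := by
    have := hu.mul hl
    rw [zero_mul] at this
    refine this.congr' ?_
    filter_upwards [ev_ne.filter_mono le_sup_left] with y hy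
    rw [← mul_assoc, inv_mul_cancel₀ hy, one_mul]
  refine ⟨?_, ?_⟩
  · refine ge_of_tendsto him ?_
    filter_upwards [eventually_gt_atTop 0] with y hy
    exact mul_nonneg hy.le (hn.2.2 _ (by simpa using hy))
  · intro z hz
    have hL : Tendsto (fun y : ℝ => z.im * Complex.normSq (n z - (starRingEnd ℂ) (n (Complex.I * y))))
        atTop (nhds (z.im * Complex.normSq (n z))) := by
      have c : Continuous (fun u : ℂ => z.im * Complex.normSq (n z - (starRingEnd ℂ) u)) := by
        have := Complex.continuous_normSq
        have := Complex.continuous_conj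
        fun_prop
      simpa [Function.comp_def] using (c.tendsto 0).comp hn0
    have hR : Tendsto (fun y : ℝ => (y * (n (Complex.I * y)).im) * (n z).im *
        Complex.normSq (z * (Complex.I * y)⁻¹ + 1)) atTop (nhds (s 0 * (n z).im)) := by
      have c : Continuous (fun u : ℂ => Complex.normSq (z * u + 1)) := by
        have := Complex.continuous_normSq
        fun_prop
      have := (him.mul_const (n z).im).mul ((c.tendsto 0).comp hu)
      simpa [Function.comp_def] using this
    refine le_of_tendsto_of_tendsto hL hR ?_
    filter_upwards [eventually_gt_atTop 0] with y hy
    have := pick n (nev_diff n hn) hn.2.2 z (Complex.I * y) hz (by simpa using hy)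
    have e : z - (starRingEnd ℂ) (Complex.I * y) = (z * (Complex.I * y)⁻¹ + 1) * (Complex.I * y) := by
      have : (y:ℂ) ≠ 0 := by exact_mod_cast hy.ne'
      have : Complex.I * (y:ℂ) ≠ 0 := by simpa using this
      rw [add_mul, mul_assoc, inv_mul_cancel₀ this]
      simp
    rw [e, Complex.normSq_mul (z * _ + 1)] at this
    have e2 : Complex.normSq (Complex.I * (y:ℂ)) = y ^ 2 := by simp [Complex.normSq_apply]; ring
    have e3 : (Complex.I * (y:ℂ)).im = y := by simp
    rw [e2, e3] at this
    refine le_of_mul_le_mul_left ?_ hy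
    nlinarith [this]

theorem s0_pos (n : ℂ → ℂ) (hn : IsNevanlinna n) (p : ℕ) (s : ℕ → ℝ) (h : Cond1 n p s)
    (hD : 0 < hankelDet s p) : 0 < s 0 ∧ ∀ z : ℂ, 0 < z.im → n z ≠ 0 := by
  have hJ := julia n hn p s h
  have hnot : ¬ ∀ z : ℂ, 0 < z.im → n z = 0 := by
    intro hz
    have h0 : Cond1 (fun _ => 0) p (fun _ => 0) := by
      unfold Cond1; simp
    have := cond_unique n p s (fun _ => 0) (fun _ => 0) (fun y hy => hz _ (by simpa using hy)) h h0
    have : hankelDet s p = 0 := by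
      unfold hankelDet
      have : (Matrix.of fun i j : Fin (p + 1) => s ((i : ℕ) + (j : ℕ))) = 0 := by
        ext i j
        exact this _ (by omega)
      rw [this]; exact Matrix.det_zero
    linarith
  refine ⟨lt_of_le_of_ne hJ.1 ?_, ?_⟩
  · intro hs
    apply hnot
    intro z hz
    have := hJ.2 z hz
    rw [← hs, zero_mul] at this
    have h2 : Complex.normSq (n z) ≤ 0 := by
      by_contra hc
      push Not at hc
      linarith [mul_pos hz hc]
    exact Complex.normSq_eq_zero.1 (le_antisymm h2 (Complex.normSq_nonneg _))
  · intro w hw hw0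
    apply hnot
    intro z hz
    have := pick n (nev_diff n hn) hn.2.2 z w hz hw
    rw [hw0] at this
    simp only [map_zero, sub_zero, Complex.zero_im, mul_zero, zero_mul] at this
    have h2 : Complex.normSq (n z) ≤ 0 := by
      by_contra hc
      push Not at hc
      linarith [mul_pos (mul_pos hz hw) hc]
    exact Complex.normSq_eq_zero.1 (le_antisymm h2 (Complex.normSq_nonneg _))

theorem schur_nev (n : ℂ → ℂ) (hn : IsNevanlinna n) (p : ℕ) (s : ℕ → ℝ) (h : Cond1 n p s)
    (hD : 0 < hankelDet s p) :
    IsNevanlinna (fun z : ℂ => -(s 0 : ℂ) / n z - z + (s 1 : ℂ) / (s 0 : ℂ)) := by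
  obtain ⟨hs, hne⟩ := s0_pos n hn p s h hD
  have hJ := (julia n hn p s h).2
  have hne' : ∀ z : ℂ, z.im ≠ 0 → n z ≠ 0 := by
    intro z hz
    rcases lt_or_gt_of_ne hz with hz' | hz'
    · have := hne ((starRingEnd ℂ) z) (by simpa using hz')
      rw [hn.2.1 z hz] at this
      simpa using this
    · exact hne z hz'
  refine ⟨?_, ?_, ?_⟩
  · exact ((analyticOn_const.div hn.1 hne').sub analyticOn_id).add analyticOn_const
  · intro z hz
    simp only [hn.2.1 z hz]
    simp
  · intro z hz
    have hp := Complex.normSq_pos.2 (hne z hz)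
    have e : (-(s 0 : ℂ) / n z - z + (s 1 : ℂ) / (s 0 : ℂ)).im =
      s 0 * (n z).im / Complex.normSq (n z) - z.im := by
      rw [← Complex.ofReal_div]
      simp [Complex.div_im]
      ring
    rw [e, sub_nonneg, le_div_iff₀ hp]
    exact hJ z hz

theorem all_pos (p : ℕ) : ∀ (n : ℂ → ℂ) (s : ℕ → ℝ), IsNevanlinna n → Cond1 n p s →
    0 < hankelDet s p → ∀ k ≤ p, 0 < hankelDet s k := by
  induction p with
  | zero =>
    intro n s hn h hD k hk
    obtain rfl : k = 0 := by omega
    exact hD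
  | succ p ih =>
    intro n s hn h hD k hk
    have hs := (s0_pos n hn _ s h hD).1
    have hh := hankel_shat s hs.ne'
    cases k with
    | zero => simpa [hankelDet] using hs
    | succ k =>
      rw [hh]
      refine mul_pos (by positivity) ?_
      refine ih _ (shat s) (schur_nev n hn _ s h hD) (cond_exists n p s hs.ne' h) ?_ k (by omega)
      rw [hh] at hD
      exact pos_of_mul_pos_right hD (by positivity)

theorem hankelDet_congr (s t : ℕ → ℝ) (k : ℕ) (h : ∀ j ≤ 2 * k, s j = t j) :
    hankelDet s k = hankelDet t k := by
  unfold hankelDet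
  congr 2
  ext i j
  exact h _ (by omega)

theorem ePoly_congr (s t : ℕ → ℝ) (k : ℕ) (h : ∀ j ≤ 2 * k, s j = t j) :
    ePoly s k = ePoly t k := by
  cases k with
  | zero => simp [ePoly, h 0]
  | succ k =>
    simp only [ePoly]
    rw [hankelDet_congr s t k (fun j hj => h j (by omega)), hankelDet_congr s t (k + 1) h]
    congr 3
    ext1 i
    ext1 j
    split_ifs with hi
    · rw [h _ (by omega)]
    · rfl

/-- if `n` is Nevanlinna with `(1_p)`, `D_p > 0`, and `sh` are the coefficients
of the expansion `(1_{p-1})` of the Schur transform `n̂`, then all Hankel determinants `D̂_k`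
(`k ≤ p-1`) are positive and `ê_k(z) = d_{k+1}(z)/√s₀` for `k = 0,…,p-1`. -/
theorem first_kind_polys_of_schur_transform (p : ℕ) (hp : 2 ≤ p) (n : ℂ → ℂ)
    (hn : IsNevanlinna n) (s : ℕ → ℝ) (h1p : Cond1 n p s)
    (hDp : 0 < hankelDet s p)
    (sh : ℕ → ℝ)
    (hsh : Cond1 (fun z : ℂ => -(s 0 : ℂ) / n z - z + (s 1 : ℂ) / (s 0 : ℂ)) (p - 1) sh) :
    (∀ k ≤ p - 1, 0 < hankelDet sh k) ∧
    ∀ k ≤ p - 1, ∀ z : ℂ,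
      Polynomial.aeval z (ePoly sh k) =
        Polynomial.aeval z (dPoly s (k + 1)) / (Real.sqrt (s 0) : ℂ) := by

  obtain ⟨q, rfl⟩ : ∃ q, p = q + 1 := ⟨p - 1, by omega⟩
  simp only [Nat.add_sub_cancel] at hsh ⊢
  have hs := (s0_pos n hn _ s h1p hDp).1
  have hpos := all_pos _ n s hn h1p hDp
  have heq := cond_unique _ q sh (shat s) _ (fun _ _ => rfl) hsh (cond_exists n q s hs.ne' h1p)
  refine ⟨?_, ?_⟩
  · intro k hk
    rw [hankelDet_congr sh (shat s) k (fun j hj => heq j (by omega))]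
    have := hpos (k + 1) (by omega)
    rw [hankel_shat s hs.ne'] at this
    exact pos_of_mul_pos_right this (by positivity)
  · intro k hk z
    rw [ePoly_congr sh (shat s) k (fun j hj => heq j (by omega)),
      ePoly_shat s hs k (fun j hj => hpos j (by omega))]
    simp
    ring
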